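/- For every integer m ≥ 0, the function x ↦ 1/V_m(x) is convex on (0, ∞). -/

import Mathlib

open MeasureTheory Real Set

/-- The one-dimensional regularized Coulomb potential `V_m(x)` for integer `m ≥ 0`. -/
noncomputable def V (m : ℕ) (x : ℝ) : ℝ :=
  (1 / (Nat.factorial m : ℝ)) *
    ∫ u in Set.Ioi (0:ℝ), u ^ m * Real.exp (-u) / Real.sqrt (x ^ 2 + u)

/-- The Stieltjes-type transform `∫₀^∞ uᵐ e⁻ᵘ (s + u)⁻ᵃ du` of the Gamma weight. -/
noncomputable def gammaStieltjes (m : ℕ) (a s : ℝ) : ℝ :=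
  ∫ u in Ioi (0:ℝ), u ^ m * exp (-u) * (s + u) ^ (-a)

lemma integrableOn_pow_mul_exp_neg (m : ℕ) :
    IntegrableOn (fun u : ℝ => u ^ m * exp (-u)) (Ioi 0) := by
  have h := Real.GammaIntegral_convergent (s := (m : ℝ) + 1) (by positivity)
  refine h.congr_fun (fun u _ => ?_) measurableSet_Ioi
  simp [mul_comm]

lemma rpow_neg_add_le {a d s u : ℝ} (ha : 0 ≤ a) (hd : 0 < d) (hs : d ≤ s) (hu : 0 ≤ u) :
    (s + u) ^ (-a) ≤ d ^ (-a) :=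
  rpow_le_rpow_of_nonpos hd (by linarith) (by linarith)

lemma aestronglyMeasurable_gammaStieltjes (m : ℕ) (a s : ℝ) :
    AEStronglyMeasurable (fun u : ℝ => u ^ m * exp (-u) * (s + u) ^ (-a))
      (volume.restrict (Ioi 0)) := by
  have : Measurable (fun u : ℝ => u ^ m * exp (-u) * (s + u) ^ (-a)) := by fun_prop
  exact this.aestronglyMeasurable

lemma integrableOn_gammaStieltjes (m : ℕ) {a s : ℝ} (ha : 0 ≤ a) (hs : 0 < s) :
    IntegrableOn (fun u : ℝ => u ^ m * exp (-u) * (s + u) ^ (-a)) (Ioi 0) := by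
  refine Integrable.mono' ((integrableOn_pow_mul_exp_neg m).mul_const (s ^ (-a)))
    (aestronglyMeasurable_gammaStieltjes m a s) ?_
  filter_upwards [ae_restrict_mem measurableSet_Ioi] with u hu
  have hu' : (0:ℝ) < u := hu
  rw [norm_of_nonneg (by positivity)]
  refine mul_le_mul_of_nonneg_left ?_ (by positivity)
  exact rpow_neg_add_le ha hs le_rfl hu'.le

lemma gammaStieltjes_pos (m : ℕ) {a s : ℝ} (ha : 0 ≤ a) (hs : 0 < s) :
    0 < gammaStieltjes m a s := by
  have h0 : ∀ u ∈ Ioi (0:ℝ), 0 < u ^ m * exp (-u) * (s + u) ^ (-a) := by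
    intro u hu
    have hu' : (0:ℝ) < u := hu
    positivity
  unfold gammaStieltjes
  rw [setIntegral_pos_iff_support_of_nonneg_ae _ (integrableOn_gammaStieltjes m ha hs)]
  · have : Ioi (0:ℝ) ⊆ Function.support (fun u : ℝ => u ^ m * exp (-u) * (s + u) ^ (-a)) ∩ Ioi 0 :=
      fun u hu => ⟨(h0 u hu).ne', hu⟩
    exact lt_of_lt_of_le (by simp) (measure_mono this)
  · filter_upwards [ae_restrict_mem measurableSet_Ioi] with u hu using (h0 u hu).le

lemma hasDerivAt_gammaStieltjes (m : ℕ) {a s : ℝ} (ha : 0 ≤ a) (hs : 0 < s) :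
    HasDerivAt (gammaStieltjes m a) (-a * gammaStieltjes m (a + 1) s) s := by
  have hball : ∀ x ∈ Metric.ball s (s / 2), s / 2 ≤ x := by
    intro x hx
    rw [Metric.mem_ball, Real.dist_eq, abs_lt] at hx
    linarith [hx.1]
  have key := (hasDerivAt_integral_of_dominated_loc_of_deriv_le
    (μ := volume.restrict (Ioi (0:ℝ)))
    (F := fun s u : ℝ => u ^ m * exp (-u) * (s + u) ^ (-a))
    (F' := fun s u : ℝ => -a * (u ^ m * exp (-u) * (s + u) ^ (-(a + 1))))
    (bound := fun u => a * (u ^ m * exp (-u) * (s / 2) ^ (-(a + 1))))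
    (x₀ := s) (Metric.ball_mem_nhds s (half_pos hs))
    (Filter.Eventually.of_forall fun x => aestronglyMeasurable_gammaStieltjes m a x)
    (integrableOn_gammaStieltjes m ha hs)
    ((aestronglyMeasurable_gammaStieltjes m (a + 1) s).const_mul _) ?_
    (((integrableOn_pow_mul_exp_neg m).mul_const _).const_mul _) ?_).2
  · rwa [integral_const_mul] at key
  · filter_upwards [ae_restrict_mem measurableSet_Ioi] with u hu x hx
    have hu' : (0:ℝ) < u := hu
    have hx' := hball x hx
    have hx0 : 0 < x := by linarith
    rw [norm_mul, norm_neg, norm_of_nonneg ha, norm_of_nonneg (by positivity)]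
    refine mul_le_mul_of_nonneg_left (mul_le_mul_of_nonneg_left ?_ (by positivity)) ha
    exact rpow_neg_add_le (by linarith) (half_pos hs) hx' hu'.le
  · filter_upwards [ae_restrict_mem measurableSet_Ioi] with u hu x hx
    have hu' : (0:ℝ) < u := hu
    have hx' := hball x hx
    have h1 : HasDerivAt (fun y : ℝ => (y + u) ^ (-a)) (1 * (-a) * (x + u) ^ (-a - 1)) x :=
      ((hasDerivAt_id x).add_const u).rpow_const (Or.inl (by simp; linarith))
    refine (h1.const_mul (u ^ m * exp (-u))).congr_deriv ?_
    rw [show -(a + 1) = -a - 1 by ring]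
    ring

/-- Three-term recurrence in the exponent, from integrating by parts. -/
lemma gammaStieltjes_recurrence (m : ℕ) {a s : ℝ} (ha : 1 ≤ a) (hs : 0 < s) :
    a * s * gammaStieltjes m (a + 1) s =
      gammaStieltjes m (a - 1) s - (m + 1 + s - a) * gammaStieltjes m a s := by
  have i0 := integrableOn_gammaStieltjes m (a := a - 1) (by linarith) hs
  have i1 := integrableOn_gammaStieltjes m (a := a) (by linarith) hs
  have i2 := integrableOn_gammaStieltjes m (a := a + 1) (by linarith) hs
  have j := ((i1.const_mul (m + 1 + s - a)).sub i0).add (i2.const_mul (a * s))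
  have hderiv : ∀ u ∈ Ici (0:ℝ), HasDerivAt
      (fun u : ℝ => u ^ (m + 1) * exp (-u) * (s + u) ^ (-a))
      ((m + 1 + s - a) * (u ^ m * exp (-u) * (s + u) ^ (-a))
        - u ^ m * exp (-u) * (s + u) ^ (-(a - 1))
        + a * s * (u ^ m * exp (-u) * (s + u) ^ (-(a + 1)))) u := by
    intro u hu
    have hr : 0 < s + u := by have : (0:ℝ) ≤ u := hu; linarith
    have h1 : HasDerivAt (fun y : ℝ => (s + y) ^ (-a)) (1 * (-a) * (s + u) ^ (-a - 1)) u :=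
      ((hasDerivAt_id u).const_add s).rpow_const (Or.inl hr.ne')
    have h2 : HasDerivAt (fun y : ℝ => exp (-y)) (exp (-u) * -1) u := (hasDerivAt_neg u).exp
    refine (((hasDerivAt_pow (m + 1) u).mul h2).mul h1).congr_deriv ?_
    have e1 : (s + u) ^ (-a) = (s + u) ^ (-(a + 1)) * (s + u) := by
      rw [← rpow_add_one hr.ne']; congr 1; ring
    have e2 : (s + u) ^ (-(a - 1)) = (s + u) ^ (-(a + 1)) * (s + u) * (s + u) := by
      rw [← rpow_add_one hr.ne', ← rpow_add_one hr.ne']; congr 1; ring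
    rw [e2, e1, show -a - 1 = -(a + 1) by ring]
    simp only [Nat.add_sub_cancel, Pi.mul_apply]
    push_cast
    ring
  have hlim : Filter.Tendsto (fun u : ℝ => u ^ (m + 1) * exp (-u) * (s + u) ^ (-a))
      Filter.atTop (nhds 0) := by
    have h := (tendsto_pow_mul_exp_neg_atTop_nhds_zero (m + 1)).mul_const (s ^ (-a))
    rw [zero_mul] at h
    refine squeeze_zero' ?_ ?_ h
    · filter_upwards [Filter.eventually_gt_atTop 0] with u hu
      positivity
    · filter_upwards [Filter.eventually_gt_atTop 0] with u hu
      refine mul_le_mul_of_nonneg_left ?_ (by positivity)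
      exact rpow_neg_add_le (by linarith) hs le_rfl hu.le
  have h := integral_Ioi_of_hasDerivAt_of_tendsto' hderiv j hlim
  rw [integral_add (by exact (i1.const_mul (m + 1 + s - a)).sub i0) (by exact i2.const_mul (a * s)),
    integral_sub (by exact i1.const_mul (m + 1 + s - a)) i0,
    integral_const_mul, integral_const_mul] at h
  simp only [zero_pow (Nat.succ_ne_zero m), zero_mul, sub_zero] at h
  unfold gammaStieltjes
  linarith

lemma mul_gammaStieltjes_le (m : ℕ) {a s : ℝ} (ha : 0 ≤ a) (hs : 0 < s) :
    s * gammaStieltjes m (a + 1) s ≤ gammaStieltjes m a s := by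
  unfold gammaStieltjes
  rw [← integral_const_mul]
  refine setIntegral_mono_on ((integrableOn_gammaStieltjes m (by linarith) hs).const_mul s)
    (integrableOn_gammaStieltjes m ha hs) measurableSet_Ioi fun u hu => ?_
  have hu' : (0:ℝ) < u := hu
  have e1 : (s + u) ^ (-a) = (s + u) ^ (-(a + 1)) * (s + u) := by
    rw [← rpow_add_one (by positivity)]; congr 1; ring
  rw [e1]
  have : 0 ≤ u * (u ^ m * exp (-u) * (s + u) ^ (-(a + 1))) := by positivity
  linarith

lemma gammaStieltjes_le (m : ℕ) {a s : ℝ} (ha : 0 ≤ a) (hs : 1 ≤ s) :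
    gammaStieltjes m a s ≤ ∫ u in Ioi (0:ℝ), u ^ m * exp (-u) := by
  refine setIntegral_mono_on (integrableOn_gammaStieltjes m ha (by linarith))
    (integrableOn_pow_mul_exp_neg m) measurableSet_Ioi fun u hu => ?_
  have hu' : (0:ℝ) < u := hu
  have h := rpow_neg_add_le ha one_pos hs hu'.le
  rw [one_rpow] at h
  exact mul_le_of_le_one_right (by positivity) h

/-- The quadratic form in `I_{1/2}`, `I_{3/2}` whose sign governs convexity of `1 / V m`. -/
noncomputable def convexityForm (m : ℕ) (s : ℝ) : ℝ :=
  s * gammaStieltjes m (3 / 2) s ^ 2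
    + (m + s) * gammaStieltjes m (1 / 2) s * gammaStieltjes m (3 / 2) s
    - gammaStieltjes m (1 / 2) s ^ 2

lemma hasDerivAt_gammaStieltjes_half (m : ℕ) {s : ℝ} (hs : 0 < s) :
    HasDerivAt (gammaStieltjes m (1 / 2)) (-(1 / 2) * gammaStieltjes m (3 / 2) s) s := by
  have h := hasDerivAt_gammaStieltjes m (a := 1 / 2) (by norm_num) hs
  norm_num at h ⊢
  exact h

lemma hasDerivAt_gammaStieltjes_three_halves (m : ℕ) {s : ℝ} (hs : 0 < s) :
    HasDerivAt (gammaStieltjes m (3 / 2))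
      (((m - 1 / 2 + s) * gammaStieltjes m (3 / 2) s - gammaStieltjes m (1 / 2) s) / s) s := by
  refine (hasDerivAt_gammaStieltjes m (a := 3 / 2) (by norm_num) hs).congr_deriv ?_
  have h := gammaStieltjes_recurrence m (a := 3 / 2) (by norm_num) hs
  rw [show (3 / 2 - 1 : ℝ) = 1 / 2 by norm_num] at h
  rw [eq_div_iff hs.ne']
  linarith

lemma hasDerivAt_convexityForm (m : ℕ) {s : ℝ} (hs : 0 < s) :
    HasDerivAt (convexityForm m) ((m + s) / s * (convexityForm m s
      - gammaStieltjes m (3 / 2) s *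
        (gammaStieltjes m (1 / 2) s - s * gammaStieltjes m (3 / 2) s) / 2)) s := by
  have hA := hasDerivAt_gammaStieltjes_half m hs
  have hB := hasDerivAt_gammaStieltjes_three_halves m hs
  have hid := hasDerivAt_id s
  refine (((hid.mul (hB.pow 2)).add (((hid.const_add (m : ℝ)).mul hA).mul hB)).sub
    (hA.pow 2)).congr_deriv ?_
  simp only [convexityForm, Pi.mul_apply, Pi.pow_apply, id]
  field_simp
  push_cast
  ring

lemma convexityForm_nonneg (m : ℕ) {s : ℝ} (hs : 0 < s) : 0 ≤ convexityForm m s := by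
  set E : ℝ → ℝ := fun t => exp (-t - m * log t)
  have hE : ∀ t > 0, HasDerivAt E (E t * (-1 - m * t⁻¹)) t := fun t ht =>
    ((hasDerivAt_neg t).sub ((hasDerivAt_log ht.ne').const_mul (m : ℝ))).exp
  have hG : ∀ t > 0, HasDerivAt (fun t => convexityForm m t * E t)
      (-(E t * ((m + t) / t) * (gammaStieltjes m (3 / 2) t *
        (gammaStieltjes m (1 / 2) t - t * gammaStieltjes m (3 / 2) t) / 2))) t := by
    intro t ht
    refine ((hasDerivAt_convexityForm m ht).mul (hE t ht)).congr_deriv ?_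
    field_simp
    ring
  have hanti : AntitoneOn (fun t => convexityForm m t * E t) (Ioi 0) := by
    refine antitoneOn_of_deriv_nonpos (convex_Ioi 0)
      (fun t ht => (hG t ht).continuousAt.continuousWithinAt)
      (fun t ht => ?_) (fun t ht => ?_)
    · rw [interior_Ioi] at ht
      exact (hG t ht).differentiableAt.differentiableWithinAt
    · rw [interior_Ioi] at ht
      have ht' : 0 < t := ht
      rw [(hG t ht).deriv]
      have hB := gammaStieltjes_pos m (a := 3 / 2) (by norm_num) ht
      have hAB := mul_gammaStieltjes_le m (a := 1 / 2) (by norm_num) ht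
      rw [show (1 / 2 + 1 : ℝ) = 3 / 2 by norm_num] at hAB
      have := sub_nonneg.2 hAB
      have hEt : 0 < E t := exp_pos _
      rw [neg_nonpos]
      positivity
  set c := ∫ u in Ioi (0:ℝ), u ^ m * exp (-u)
  have hlow : ∀ t ≥ max 1 s, -(c ^ 2 * exp (-t)) ≤ convexityForm m s * E s := by
    intro t ht
    have h1 : 1 ≤ t := (le_max_left _ _).trans ht
    have ht0 : 0 < t := by linarith
    refine le_trans ?_ (hanti hs ht0 ((le_max_right _ _).trans ht))
    have hB := gammaStieltjes_pos m (a := 3 / 2) (by norm_num) ht0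
    have hA := gammaStieltjes_pos m (a := 1 / 2) (by norm_num) ht0
    have hAc : gammaStieltjes m (1 / 2) t ≤ c := gammaStieltjes_le m (by norm_num) h1
    have hEt : E t ≤ exp (-t) := by
      apply exp_le_exp.2
      have := mul_nonneg (Nat.cast_nonneg (α := ℝ) m) (log_nonneg h1)
      linarith
    have hE0 : 0 < E t := exp_pos _
    have hF : -(c ^ 2) ≤ convexityForm m t := by
      unfold convexityForm
      have : gammaStieltjes m (1 / 2) t ^ 2 ≤ c ^ 2 := by gcongr
      have : 0 ≤ t * gammaStieltjes m (3 / 2) t ^ 2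
        + (m + t) * gammaStieltjes m (1 / 2) t * gammaStieltjes m (3 / 2) t := by positivity
      linarith
    calc -(c ^ 2 * exp (-t)) ≤ -(c ^ 2 * E t) := by gcongr
      _ = -(c ^ 2) * E t := by ring
      _ ≤ convexityForm m t * E t := by gcongr
  have hlim : Filter.Tendsto (fun t : ℝ => -(c ^ 2 * exp (-t))) Filter.atTop (nhds 0) := by
    simpa using (tendsto_exp_neg_atTop_nhds_zero.const_mul (c ^ 2)).neg
  have := le_of_tendsto hlim (Filter.eventually_atTop.2 ⟨_, hlow⟩)
  exact nonneg_of_mul_nonneg_left this (exp_pos _)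

lemma V_eq_gammaStieltjes (m : ℕ) {x : ℝ} (hx : 0 < x) :
    V m x = 1 / (Nat.factorial m : ℝ) * gammaStieltjes m (1 / 2) (x ^ 2) := by
  unfold V gammaStieltjes
  congr 1
  refine setIntegral_congr_fun measurableSet_Ioi fun u hu => ?_
  have hu' : (0:ℝ) < u := hu
  rw [sqrt_eq_rpow, rpow_neg (by positivity), div_eq_mul_inv]

lemma convexOn_inv_gammaStieltjes_sq (m : ℕ) :
    ConvexOn ℝ (Ioi 0) (fun x => 1 / gammaStieltjes m (1 / 2) (x ^ 2)) := by
  have hsq : ∀ x : ℝ, HasDerivAt (fun x : ℝ => x ^ 2) (2 * x) x := fun x => by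
    simpa using hasDerivAt_pow 2 x
  have hpos : ∀ x ∈ Ioi (0:ℝ), 0 < gammaStieltjes m (1 / 2) (x ^ 2) := fun x hx =>
    gammaStieltjes_pos m (by norm_num) (pow_pos hx 2)
  have hA : ∀ x ∈ Ioi (0:ℝ), HasDerivAt (fun x => gammaStieltjes m (1 / 2) (x ^ 2))
      (-(1 / 2) * gammaStieltjes m (3 / 2) (x ^ 2) * (2 * x)) x := fun x hx =>
    HasDerivAt.comp (h := fun x : ℝ => x ^ 2) x
      (hasDerivAt_gammaStieltjes_half m (pow_pos hx 2)) (hsq x)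
  have hB : ∀ x ∈ Ioi (0:ℝ), HasDerivAt (fun x => gammaStieltjes m (3 / 2) (x ^ 2))
      (((m - 1 / 2 + x ^ 2) * gammaStieltjes m (3 / 2) (x ^ 2) - gammaStieltjes m (1 / 2) (x ^ 2))
        / x ^ 2 * (2 * x)) x := fun x hx =>
    HasDerivAt.comp (h := fun x : ℝ => x ^ 2) x
      (hasDerivAt_gammaStieltjes_three_halves m (pow_pos hx 2)) (hsq x)
  have h1 : ∀ x ∈ Ioi (0:ℝ), HasDerivAt (fun x => 1 / gammaStieltjes m (1 / 2) (x ^ 2))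
      (x * gammaStieltjes m (3 / 2) (x ^ 2) / gammaStieltjes m (1 / 2) (x ^ 2) ^ 2) x := by
    intro x hx
    simp only [one_div (gammaStieltjes _ _ _)]
    refine ((hA x hx).fun_inv (hpos x hx).ne').congr_deriv ?_
    ring
  have h2 : ∀ x ∈ Ioi (0:ℝ), HasDerivAt
      (fun x => x * gammaStieltjes m (3 / 2) (x ^ 2) / gammaStieltjes m (1 / 2) (x ^ 2) ^ 2)
      (2 * convexityForm m (x ^ 2) / gammaStieltjes m (1 / 2) (x ^ 2) ^ 3) x := by
    intro x hx
    have hA0 := (hpos x hx).ne'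
    have hx0 : x ≠ 0 := ne_of_gt hx
    refine (((hasDerivAt_id x).mul (hB x hx)).div ((hA x hx).pow 2)
      (pow_ne_zero 2 hA0)).congr_deriv ?_
    simp only [convexityForm, Pi.mul_apply, Pi.pow_apply, id]
    field_simp
    push_cast
    ring
  refine convexOn_of_hasDerivWithinAt2_nonneg (convex_Ioi 0)
    (fun x hx => (h1 x hx).continuousAt.continuousWithinAt)
    (fun x hx => (h1 x (by simpa using hx)).hasDerivWithinAt)
    (fun x hx => (h2 x (by simpa using hx)).hasDerivWithinAt) (fun x hx => ?_)
  rw [interior_Ioi] at hx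
  have := hpos x hx
  have := convexityForm_nonneg m (pow_pos hx 2)
  positivity

theorem inv_V_convex (m : ℕ) : ConvexOn ℝ (Set.Ioi 0) (fun x => 1 / V m x) := by
  refine ((convexOn_inv_gammaStieltjes_sq m).smul
    (Nat.cast_nonneg (α := ℝ) (Nat.factorial m))).congr fun x hx => ?_
  simp only [V_eq_gammaStieltjes m hx, smul_eq_mul]
  field_simp
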